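/- For every n ≥ 1, the Gram matrix (⟨e_M, e_N⟩), indexed by the non-crossing partial matchings of [n], has rank 2^{n−1} over ℚ; equivalently, the quotient of the ℚ-vector space with basis {e_M} by the radical of the form ⟨·,·⟩ has dimension 2^{n−1}. (This is the paper's computation that the quotient planar algebra space P′_n has dimension 2^{n−1}, the number of even-cardinality subsets of the n boundary points.) -/

import Mathlib

open Finset LaurentPolynomial

/-- The Laurent polynomial ring `ℤ[q, q⁻¹]`. -/
abbrev R : Type := LaurentPolynomial ℤ

/-- `M` is a non-crossing partial matching of the `n` points `0, …, n-1`,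
taken in circular order on the boundary of a disk: a set of chords `(a, b)` with `a < b`
(each recording the two-element subset `{a, b}`), pairwise disjoint, and with no two chords
`{a, b}`, `{c, d}` satisfying `a < c < b < d`. -/
def IsNCPM (n : ℕ) (M : Finset (Fin n × Fin n)) : Prop :=
  (∀ p ∈ M, p.1 < p.2) ∧
    (∀ p ∈ M, ∀ q ∈ M, p ≠ q → p.1 ≠ q.1 ∧ p.1 ≠ q.2 ∧ p.2 ≠ q.1 ∧ p.2 ≠ q.2) ∧
    (∀ p ∈ M, ∀ q ∈ M, ¬(p.1 < q.1 ∧ q.1 < p.2 ∧ p.2 < q.2))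

instance (n : ℕ) : DecidablePred (IsNCPM n) := fun M =>
  have h1 : Decidable (∀ p ∈ M, p.1 < p.2) := inferInstance
  have h2 : Decidable
      (∀ p ∈ M, ∀ q ∈ M, p ≠ q → p.1 ≠ q.1 ∧ p.1 ≠ q.2 ∧ p.2 ≠ q.1 ∧ p.2 ≠ q.2) :=
    inferInstance
  have h3 : Decidable (∀ p ∈ M, ∀ q ∈ M, ¬(p.1 < q.1 ∧ q.1 < p.2 ∧ p.2 < q.2)) :=
    inferInstance
  @instDecidableAnd _ _ h1 (@instDecidableAnd _ _ h2 h3)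

/-- The type of non-crossing partial matchings of `[n]`. -/
abbrev NCPM (n : ℕ) : Type := {M : Finset (Fin n × Fin n) // IsNCPM n M}

/-- `Pn n`: the free `ℤ[q,q⁻¹]`-module on the non-crossing partial matchings of `[n]`,
modeling the planar-algebra space of crossingless diagrams in a disk with `n` boundary
points. -/
abbrev Pn (n : ℕ) : Type := NCPM n →₀ R

/-- `e M`: the basis diagram of `Pn n` corresponding to the matching `M`. -/
noncomputable def e {n : ℕ} (M : NCPM n) : Pn n := Finsupp.single M 1

/-- The matched set of a set of chords: the union of its chords. -/
def matchedSet {V : Type*} [DecidableEq V] (E : Finset (V × V)) : Finset V :=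
  E.biUnion fun p => {p.1, p.2}

/-- The multigraph on `[n]` whose edges are the chords of `M` together with the chords of `N`
(a chord occurring in both counting as a double edge, forming a 2-cycle) contains a cycle.
For `M`, `N` partial matchings this happens exactly when some nonempty `A ⊆ M` and
nonempty `B ⊆ N` have the same matched set. -/
def HasCycle {n : ℕ} (M N : Finset (Fin n × Fin n)) : Prop :=
  ∃ A ⊆ M, A.Nonempty ∧ ∃ B ⊆ N, B.Nonempty ∧ matchedSet A = matchedSet B

instance {n : ℕ} (M N : Finset (Fin n × Fin n)) : Decidable (HasCycle M N) := by
  unfold HasCycle; infer_instance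

section Involutions

/-- `S` is stable under `f`, and `f` has no fixed point in `S`. -/
def FreelyStable {α : Type*} (f : α → α) (S : Finset α) : Prop := ∀ x ∈ S, f x ∈ S ∧ f x ≠ x

lemma even_card_of_freelyStable {α : Type*} {f : α → α} (hf : Function.Involutive f) {S : Finset α}
    (hS : FreelyStable f S) : Even #S := by
  have h : ∑ x ∈ S, (1 : ZMod 2) = 0 :=
    sum_involution (fun x _ => f x) (fun _ _ => by decide) (fun x hx _ => (hS x hx).2)
      (fun x hx => (hS x hx).1) (fun x _ => hf x)
  rw [sum_const, nsmul_eq_mul, mul_one] at h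
  exact (ZMod.natCast_eq_zero_iff_even).1 h

variable {α : Type*} [LinearOrder α]

instance (f : α → α) : DecidablePred (FreelyStable f) := fun S =>
  inferInstanceAs (Decidable (∀ x ∈ S, f x ∈ S ∧ f x ≠ x))

/-- No two chords of `f` with endpoints in `S` cross. -/
def NoncrossingOn (f : α → α) (S : Finset α) : Prop :=
  ∀ x ∈ S, ∀ y ∈ S, ¬(x < y ∧ y < f x ∧ f x < f y)

/-- The parity sign of the position of `x` relative to `S`. -/
def posSign (S : Finset α) (x : α) : ℚ := (-1) ^ #{t ∈ S | t < x}

/-- The factor of `x` in `openerSign`: the sign of its position when `x` is the smaller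
endpoint of its chord, and `1` otherwise. -/
def chordSign (f : α → α) (S : Finset α) (x : α) : ℚ := if x < f x then posSign S x else 1

/-- The product of the position signs of the smaller endpoints of the chords in `S`. -/
def openerSign (f : α → α) (S : Finset α) : ℚ := ∏ x ∈ S, chordSign f S x

lemma posSign_mul_self (S : Finset α) (x : α) : posSign S x * posSign S x = 1 := by
  rw [posSign, ← pow_add, ← two_mul, pow_mul]; simp

lemma openerSign_mul_self (f : α → α) (S : Finset α) :
    openerSign f S * openerSign f S = 1 := by
  rw [openerSign, ← prod_mul_distrib]
  refine prod_eq_one fun x _ => ?_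
  unfold chordSign
  split_ifs
  · exact posSign_mul_self S x
  · simp

/-- In a noncrossing matching the endpoints of a chord have positions of opposite parity. -/
lemma posSign_apply {f : α → α} (hf : Function.Involutive f) {S : Finset α}
    (hS : FreelyStable f S) (hnc : NoncrossingOn f S)
    {x : α} (hx : x ∈ S) : posSign S (f x) = -posSign S x := by
  have key : ∀ x ∈ S, x < f x → posSign S (f x) = -posSign S x := by
    intro x hx hlt
    have hmid : Even #{t ∈ S | x < t ∧ t < f x} := by
      refine even_card_of_freelyStable hf fun t ht => ?_
      simp only [mem_filter] at ht ⊢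
      obtain ⟨htS, h1, h2⟩ := ht
      refine ⟨⟨(hS t htS).1, ?_, ?_⟩, (hS t htS).2⟩
      · by_contra! h
        have := hnc (f t) (hS t htS).1 x hx
        rw [hf t] at this
        rcases h.lt_or_eq with h | h
        · exact this ⟨h, h1, h2⟩
        · rw [← h, hf t] at h2; exact h2.false
      · by_contra! h
        rcases h.lt_or_eq with h | h
        · exact hnc x hx t htS ⟨h1, h2, h⟩
        · rw [hf.injective h] at h1; exact h1.false
    have hsplit : ({t ∈ S | t < f x} : Finset α)
        = {t ∈ S | t < x} ∪ ({x} ∪ {t ∈ S | x < t ∧ t < f x}) := by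
      ext t
      simp only [mem_filter, mem_union, mem_singleton]
      grind
    unfold posSign
    rw [hsplit, card_union_of_disjoint, card_union_of_disjoint, card_singleton, pow_add, pow_add,
      hmid.neg_one_pow]
    · ring
    · simp
    · rw [disjoint_left]; intro t; simp only [mem_filter, mem_union, mem_singleton]; grind
  rcases lt_or_gt_of_ne (hS x hx).2 with h | h
  · have := key (f x) (hS x hx).1 (by rwa [hf x])
    rw [hf x] at this
    rw [this, neg_neg]
  · exact key x hx h

section InsertPair

variable {S : Finset α} {a b : α}

lemma posSign_insert_pair_of_mem (hab : a < b) (ha : a ∉ S) (hb : b ∉ S)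
    (hgap : ∀ x ∈ S, ¬(a < x ∧ x < b)) {x : α} (hx : x ∈ S) :
    posSign (insert a (insert b S)) x = posSign S x := by
  have hxa : x ≠ a := fun h => ha (h ▸ hx)
  have hxb : x ≠ b := fun h => hb (h ▸ hx)
  have := hgap x hx
  unfold posSign
  rw [filter_insert, filter_insert]
  rcases lt_or_gt_of_ne hxa with h | h
  · rw [if_neg h.not_gt, if_neg (h.trans hab).not_gt]
  · have hbx : b < x := by grind
    rw [if_pos h, if_pos hbx, card_insert_of_notMem, card_insert_of_notMem, pow_add, pow_add]
    · simp
    · simp [hb]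
    · simp [hab.ne, ha]

lemma posSign_insert_pair_left (hab : a < b) : posSign (insert a (insert b S)) a = posSign S a := by
  unfold posSign
  rw [filter_insert, filter_insert, if_neg (lt_irrefl a), if_neg hab.not_gt]

lemma posSign_insert_pair_right (hab : a < b) (ha : a ∉ S)
    (hgap : ∀ x ∈ S, ¬(a < x ∧ x < b)) : posSign (insert a (insert b S)) b = -posSign S a := by
  unfold posSign
  rw [filter_insert, filter_insert, if_neg (lt_irrefl b), if_pos hab, card_insert_of_notMem,
    pow_succ, mul_neg_one]
  · congr 3
    refine filter_congr fun x hx => ?_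
    have := hgap x hx
    have hxa : x ≠ a := fun h => ha (h ▸ hx)
    grind
  · simp [ha]

/-- Adding a chord with adjacent endpoints. -/
lemma openerSign_insert_pair (hab : a < b) (ha : a ∉ S) (hb : b ∉ S)
    (hgap : ∀ x ∈ S, ¬(a < x ∧ x < b)) {f : α → α} (hfa : f a = b) (hfb : f b = a) :
    openerSign f (insert a (insert b S)) = posSign S a * openerSign f S := by
  unfold openerSign
  rw [prod_insert (by simp [hab.ne, ha]), prod_insert hb]
  have h1 : chordSign f (insert a (insert b S)) a = posSign S a := by
    rw [chordSign, hfa, if_pos hab, posSign_insert_pair_left (S := S) hab]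
  have h2 : chordSign f (insert a (insert b S)) b = 1 := by
    rw [chordSign, hfb, if_neg hab.not_gt]
  rw [h1, h2, one_mul]
  congr 1
  refine prod_congr rfl fun x hx => ?_
  rw [chordSign, chordSign, posSign_insert_pair_of_mem hab ha hb hgap hx]

lemma card_insert_pair (hab : a < b) (ha : a ∉ S) (hb : b ∉ S) :
    #(insert a (insert b S)) = #S + 2 := by
  rw [card_insert_of_notMem (by simp [hab.ne, ha]), card_insert_of_notMem hb]

end InsertPair

/-- Pulling a strand straight: when `a < b` are adjacent, the chords from `a` and `b` may be
replaced by one chord joining their other endpoints. -/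
lemma openerSign_insert_pair_contract {S : Finset α} {a b : α} (hab : a < b) (ha : a ∉ S)
    (hb : b ∉ S) (hgap : ∀ x ∈ S, ¬(a < x ∧ x < b)) {g g' : α → α} (hg : Function.Involutive g)
    (hS : FreelyStable g (insert a (insert b S)))
    (hnc : NoncrossingOn g (insert a (insert b S)))
    (hgab : g a ≠ b) (hc : g' (g a) = g b) (hd : g' (g b) = g a)
    (hg' : ∀ x ∈ S, x ≠ g a → x ≠ g b → g' x = g x) :
    openerSign g (insert a (insert b S)) = -posSign S a * openerSign g' S := by
  have haS : a ∈ insert a (insert b S) := by simp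
  have hbS : b ∈ insert a (insert b S) := by simp
  have hpa := posSign_insert_pair_left (S := S) hab
  have hpb := posSign_insert_pair_right hab ha hgap
  have hpc := posSign_apply hg hS hnc haS
  have hpd := posSign_apply hg hS hnc hbS
  have hmem := fun x (hx : x ∈ S) => posSign_insert_pair_of_mem hab ha hb hgap hx
  have hgba : g b ≠ a := fun h => hgab (by rw [← h, hg])
  have hcS : g a ∈ S := by have := hS a haS; grind
  have hdS : g b ∈ S := by have := hS b hbS; grind
  have hcd : g a ≠ g b := fun h => hab.ne (hg.injective h)
  have n1 := hnc _ haS _ hbS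
  have n2 := hnc _ haS _ (hS b hbS).1
  have n3 := hnc _ (hS a haS).1 _ hbS
  have n4 := hnc _ (hS a haS).1 _ (hS b hbS).1
  have n5 := hnc _ hbS _ (hS a haS).1
  have n6 := hnc _ (hS b hbS).1 _ haS
  have n7 := hnc _ (hS b hbS).1 _ (hS a haS).1
  have gc := hgap _ hcS
  have gd := hgap _ hdS
  rw [hg a] at n3 n4 n5 n7
  rw [hg b] at n2 n4 n6 n7
  unfold openerSign
  rw [prod_insert (by simp [hab.ne, ha]), prod_insert hb, ← mul_prod_erase S _ hcS,
    ← mul_prod_erase (S.erase (g a)) _ (mem_erase.2 ⟨hcd.symm, hdS⟩),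
    ← mul_prod_erase S _ hcS, ← mul_prod_erase (S.erase (g a)) _ (mem_erase.2 ⟨hcd.symm, hdS⟩)]
  have hrest : ∏ x ∈ (S.erase (g a)).erase (g b), chordSign g (insert a (insert b S)) x
      = ∏ x ∈ (S.erase (g a)).erase (g b), chordSign g' S x := by
    refine prod_congr rfl fun x hx => ?_
    simp only [mem_erase] at hx
    rw [chordSign, chordSign, hmem x hx.2.2, hg' x hx.2.2 hx.2.1 hx.1]
  rw [hrest]
  rw [hpa, hmem _ hcS] at hpc
  rw [hpb, hmem _ hdS, neg_neg] at hpd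
  have huu := posSign_mul_self S a
  simp only [chordSign, hg a, hg b, hc, hd, hpa, hpb, hmem _ hcS, hmem _ hdS, hpc, hpd]
  generalize posSign S a = u at *
  generalize ∏ x ∈ (S.erase (g a)).erase (g b), chordSign g' S x = P at *
  have hca : g a ≠ a := (hS a haS).2
  have hdb : g b ≠ b := (hS b hbS).2
  generalize g a = c at *
  generalize g b = d at *
  clear hS hnc hmem hg' hrest
  rcases lt_or_gt_of_ne hca with h1 | h1 <;> rcases lt_or_gt_of_ne hdb with h2 | h2 <;>
    rcases lt_or_gt_of_ne hcd with h3 | h3 <;>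
    simp only [h1, h2, h3, h1.not_gt, h2.not_gt, h3.not_gt, if_true, if_false] <;>
    first
    | (exfalso; grind)
    | ring

/-- The signed contribution to the pairing of `f` and `g` of a set `S` that is a union of
chords of both. -/
def cycleSign (f g : α → α) (S : Finset α) : ℚ :=
  (-1) ^ (#S / 2) * openerSign f S * openerSign g S

lemma NoncrossingOn.lt_iff {f : α → α} {S : Finset α} (hnc : NoncrossingOn f S)
    (hf : Function.Involutive f) (hS : FreelyStable f S) {x y : α} (hx : x ∈ S) (hy : y ∈ S)
    (hxy : x ≠ y) (hxy' : f x ≠ y) : (x < y ↔ f x < y) ↔ (x < f y ↔ f x < f y) := by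
  have h1 := hnc x hx y hy
  have h2 := hnc x hx (f y) (hS y hy).1
  have h3 := hnc (f x) (hS x hx).1 y hy
  have h4 := hnc (f x) (hS x hx).1 (f y) (hS y hy).1
  have h5 := hnc y hy x hx
  have h6 := hnc y hy (f x) (hS x hx).1
  have h7 := hnc (f y) (hS y hy).1 x hx
  have h8 := hnc (f y) (hS y hy).1 (f x) (hS x hx).1
  have hne : x ≠ f y := fun h => hxy' (by rw [h, hf])
  have hne' : f x ≠ f y := fun h => hxy (hf.injective h)
  rw [hf] at h2 h3 h4 h6 h7 h8
  rw [hf] at h4 h8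
  generalize f x = x' at *
  generalize f y = y' at *
  clear hnc hf hS
  rcases lt_or_gt_of_ne hxy with i1 | i1 <;> rcases lt_or_gt_of_ne hxy' with i2 | i2 <;>
    rcases lt_or_gt_of_ne hne with i3 | i3 <;> rcases lt_or_gt_of_ne hne' with i4 | i4 <;>
    simp_all [not_lt_of_gt]

lemma openerSign_congr {f g : α → α} {S : Finset α} (h : ∀ x ∈ S, f x = g x) :
    openerSign f S = openerSign g S :=
  prod_congr rfl fun x hx => by rw [chordSign, chordSign, h x hx]

/-- A nontrivial noncrossing involution has a chord with no other matched point below it. -/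
lemma exists_innermost [Fintype α] {f : α → α} (hf : Function.Involutive f)
    (hnc : ∀ x y, ¬(x < y ∧ y < f x ∧ f x < f y)) (hne : ∃ x, f x ≠ x) :
    ∃ a, a < f a ∧ ∀ x, a < x → x < f a → f x = x := by
  have hne' : ({x | x < f x} : Finset α).Nonempty := by
    obtain ⟨x, hx⟩ := hne
    rcases lt_or_gt_of_ne hx with h | h
    · exact ⟨f x, by simpa [hf x] using h⟩
    · exact ⟨x, by simpa using h⟩
  obtain ⟨a, ha, hmax⟩ := exists_max_image _ id hne'
  simp only [mem_filter, mem_univ, true_and, id] at ha hmax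
  refine ⟨a, ha, fun x h1 h2 => ?_⟩
  by_contra hx
  rcases lt_or_gt_of_ne hx with h | h
  · have h3 := hmax (f x) (by rwa [hf x])
    rcases h3.lt_or_eq with h3 | h3
    · exact hnc (f x) a ⟨h3, by rwa [hf x], by rwa [hf x]⟩
    · rw [← h3, hf x] at h2; exact h2.false
  · exact (hmax x h).not_gt h1

/-- Delete the chord joining `a` and `b`. -/
def deleteChord (f : α → α) (a b : α) (x : α) : α := if x = a ∨ x = b then x else f x

/-- Replace the chords from `a` and `b` by a chord joining their other endpoints. -/
def contractChord (g : α → α) (a b : α) (x : α) : α :=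
  if x = a ∨ x = b then x else if x = g a then g b else if x = g b then g a else g x

lemma deleteChord_involutive {f : α → α} (hf : Function.Involutive f) {a : α} :
    Function.Involutive (deleteChord f a (f a)) := by
  intro x
  have := hf x
  have := hf a
  unfold deleteChord
  grind

lemma contractChord_involutive {g : α → α} (hg : Function.Involutive g) {a b : α}
    (ha : g a ≠ a) (hb : g b ≠ b) (hab : g a ≠ b) : Function.Involutive (contractChord g a b) := by
  have hba : g b ≠ a := fun h => hab (by rw [← h, hg])
  intro x
  have := hg x
  have := hg a
  have := hg b
  unfold contractChord
  grind

lemma freelyStable_deleteChord {f : α → α} (hf : Function.Involutive f) {a : α} {S : Finset α} :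
    FreelyStable (deleteChord f a (f a)) S ↔ FreelyStable f S ∧ a ∉ S ∧ f a ∉ S := by
  have := hf a
  unfold FreelyStable deleteChord
  constructor
  · intro h
    have ha : a ∉ S := fun ha => by have := h a ha; grind
    have hb : f a ∉ S := fun hb => by have := h _ hb; grind
    exact ⟨fun x hx => by have := h x hx; grind, ha, hb⟩
  · rintro ⟨h, ha, hb⟩ x hx
    have := h x hx
    grind

/-- The points of the union of chords of `f` and `g` obtained from such a union for the
contracted matchings. -/
def uncontract (a b c : α) (S : Finset α) : Finset α :=
  if c ∈ S then insert a (insert b S) else S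

section Contract

variable {f g : α → α} {a b : α}

lemma contractChord_apply_left (ha : g a ≠ a) (hab : g a ≠ b) :
    contractChord g a b (g a) = g b := by
  simp [contractChord, ha, hab]

lemma contractChord_apply_right (hg : Function.Involutive g) (hb : g b ≠ b) (hab : g a ≠ b) :
    contractChord g a b (g b) = g a := by
  have hba : g b ≠ a := fun h => hab (by rw [← h, hg])
  by_cases h : a = b
  · simp [contractChord, hb, h]
  · simp [contractChord, hb, hba, hg.injective.eq_iff, Ne.symm h]

lemma contractChord_apply_of_ne {S : Finset α} (ha : a ∉ S) (hb : b ∉ S) :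
    ∀ x ∈ S, x ≠ g a → x ≠ g b → contractChord g a b x = g x := by
  intro x hx h1 h2
  have hxa : x ≠ a := fun h => ha (h ▸ hx)
  have hxb : x ≠ b := fun h => hb (h ▸ hx)
  simp [contractChord, h1, h2, hxa, hxb]

lemma freelyStable_of_contractChord {S : Finset α} (hg : Function.Involutive g) (hab : g a ≠ b)
    (hS : FreelyStable (contractChord g a b) S) (hc : g a ∉ S) : FreelyStable g S := by
  have hgba : g b ≠ a := fun h => hab (by rw [← h, hg])
  have h1 := hg a
  have h2 := hg b
  intro x hx
  have h := hS x hx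
  have h' := hS (g b)
  unfold contractChord at h h'
  grind

lemma freelyStable_insert_of_contractChord {S : Finset α} (hg : Function.Involutive g)
    (hab : g a ≠ b) (ha : g a ≠ a) (hb : g b ≠ b)
    (hS : FreelyStable (contractChord g a b) S) (hc : g a ∈ S) :
    FreelyStable g (insert a (insert b S)) := by
  have hgba : g b ≠ a := fun h => hab (by rw [← h, hg])
  have h1 := hg a
  have h2 := hg b
  intro x hx
  have h := hS x
  have h' := hS (g a) hc
  have h3 := hg x
  simp only [mem_insert] at hx ⊢
  unfold contractChord at h h'
  grind

lemma freelyStable_contractChord {S : Finset α} (hg : Function.Involutive g) (hne : a ≠ b)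
    (hab : g a ≠ b) (hS : FreelyStable g S) (hmem : a ∈ S ↔ b ∈ S) :
    FreelyStable (contractChord g a b) ((S.erase a).erase b) := by
  have hgba : g b ≠ a := fun h => hab (by rw [← h, hg])
  have h1 := hg a
  have h2 := hg b
  intro x hx
  simp only [mem_erase] at hx ⊢
  have h := hS x hx.2.2
  have ha := hS a
  have hb := hS b
  have h3 := hg x
  unfold contractChord
  grind

lemma noncrossingOn_contractChord {S : Finset α} (hg : Function.Involutive g) (hlt : a < b)
    (ha : a ∉ S) (hb : b ∉ S) (hgap : ∀ x ∈ S, ¬(a < x ∧ x < b)) (hab : g a ≠ b) (hga : g a ≠ a)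
    (hgb : g b ≠ b) (hS : FreelyStable (contractChord g a b) S)
    (hnc : NoncrossingOn g (uncontract a b (g a) S)) : NoncrossingOn (contractChord g a b) S := by
  have hval := contractChord_apply_of_ne (g := g) ha hb
  by_cases hc : g a ∈ S
  · have hd : g b ∈ S := by
      have := (hS _ hc).1; rwa [contractChord_apply_left hga hab] at this
    have hu := freelyStable_insert_of_contractChord hg hab hga hgb hS hc
    rw [uncontract, if_pos hc] at hnc
    have hsub : ∀ z ∈ S, z ∈ insert a (insert b S) := fun z hz => by simp [hz]
    have hcd : g a ≠ g b := fun h => hlt.ne (hg.injective h)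
    have hc' := contractChord_apply_left hga hab
    have hd' := contractChord_apply_right hg hgb hab
    have side : ∀ z ∈ S, z ≠ g a → z ≠ g b →
        ((g a < z ↔ g b < z) ↔ (g a < g z ↔ g b < g z)) := by
      intro z hz hzc hzd
      have haz : a ≠ z := fun h => ha (h ▸ hz)
      have hbz : b ≠ z := fun h => hb (h ▸ hz)
      have hgz := hgap z hz
      have hgz' := hgap _ (hval z hz hzc hzd ▸ (hS z hz).1)
      have hwa : g z ≠ a := fun h => hzc (by rw [← h, hg])
      have hwb : g z ≠ b := fun h => hzd (by rw [← h, hg])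
      have e1 := hnc.lt_iff hg hu (x := a) (by simp) (hsub z hz) haz hzc.symm
      have e2 := hnc.lt_iff hg hu (x := b) (by simp) (hsub z hz) hbz hzd.symm
      have e3 : a < z ↔ b < z :=
        ⟨fun h => (not_lt.1 fun h' => hgz ⟨h, h'⟩).lt_of_ne hbz, hlt.trans⟩
      have e4 : a < g z ↔ b < g z :=
        ⟨fun h => (not_lt.1 fun h' => hgz' ⟨h, h'⟩).lt_of_ne hwb.symm, hlt.trans⟩
      rw [e3, e4] at e1
      clear * - e1 e2
      tauto
    intro x hx y hy
    have sx := side x hx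
    have sy := side y hy
    have vx := hval x hx
    have vy := hval y hy
    have nxy := hnc x (hsub x hx) y (hsub y hy)
    generalize contractChord g a b = g' at *
    clear side hval hnc hu hS hsub hgap
    by_cases hxc : x = g a
    · subst hxc
      by_cases hyc : y = g a
      · subst hyc; grind
      by_cases hyd : y = g b
      · subst hyd; grind
      rw [hc', vy hyc hyd]
      have := sy hyc hyd
      grind
    by_cases hxd : x = g b
    · subst hxd
      by_cases hyc : y = g a
      · subst hyc; grind
      by_cases hyd : y = g b
      · subst hyd; grind
      rw [hd', vy hyc hyd]
      have := sy hyc hyd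
      grind
    rw [vx hxc hxd]
    have := sx hxc hxd
    by_cases hyc : y = g a
    · subst hyc; grind
    by_cases hyd : y = g b
    · subst hyd; grind
    rwa [vy hyc hyd]
  · have hd : g b ∉ S := fun hd => hc <| by
      have := (hS _ hd).1; rwa [contractChord_apply_right hg hgb hab] at this
    rw [uncontract, if_neg hc] at hnc
    intro x hx y hy
    rw [hval x hx (fun h => hc (h ▸ hx)) (fun h => hd (h ▸ hx)),
      hval y hy (fun h => hc (h ▸ hy)) (fun h => hd (h ▸ hy))]
    exact hnc x hx y hy

lemma freelyStable_insert_pair {S : Finset α} (hf : Function.Involutive f) (ha : f a ≠ a)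
    (hS : FreelyStable f S) : FreelyStable f (insert a (insert (f a) S)) := by
  have h1 := hf a
  intro x hx
  have h := hS x
  simp only [mem_insert] at hx ⊢
  grind

lemma freelyStable_erase_pair {S : Finset α} (hf : Function.Involutive f)
    (hS : FreelyStable f S) : FreelyStable f ((S.erase a).erase (f a)) := by
  have h1 := hf a
  intro x hx
  simp only [mem_erase] at hx ⊢
  have h := hS x hx.2.2
  have h3 := hf x
  grind

end Contract

/-- If two noncrossing matchings form a cycle, their signed pairing vanishes. -/
theorem sum_cycleSign_eq_zero [Fintype α] {f g : α → α} (hf : Function.Involutive f)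
    (hg : Function.Involutive g) (hfnc : ∀ x y, ¬(x < y ∧ y < f x ∧ f x < f y))
    (hgnc : ∀ S, FreelyStable f S → FreelyStable g S → NoncrossingOn g S)
    (hex : ∃ S : Finset α, S.Nonempty ∧ FreelyStable f S ∧ FreelyStable g S) :
    ∑ S with FreelyStable f S ∧ FreelyStable g S, cycleSign f g S = 0 := by
  induction hk : #{x | f x ≠ x} using Nat.strong_induction_on generalizing f g with
  | _ k ih =>
  obtain ⟨S₀, ⟨x₀, hx₀⟩, hS₀f, hS₀g⟩ := hex
  obtain ⟨a, hlt, hin⟩ := exists_innermost hf hfnc ⟨x₀, (hS₀f x₀ hx₀).2⟩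
  obtain ⟨b, hfa⟩ : ∃ b, f a = b := ⟨_, rfl⟩
  have hfb : f b = a := by rw [← hfa, hf]
  rw [hfa] at hlt hin
  have hgap : ∀ S, FreelyStable f S → ∀ x ∈ S, ¬(a < x ∧ x < b) :=
    fun S hS x hx h => (hS x hx).2 (hin x h.1 h.2)
  have hmem : ∀ S, FreelyStable f S → (a ∈ S ↔ b ∈ S) := fun S hS =>
    ⟨fun h => hfa ▸ (hS a h).1, fun h => hfb ▸ (hS b h).1⟩
  set f' := deleteChord f a b with hf'def
  have hf' : Function.Involutive f' := by
    have := deleteChord_involutive hf (a := a); rwa [hfa] at this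
  have hstab : ∀ S, FreelyStable f' S ↔ FreelyStable f S ∧ a ∉ S ∧ b ∉ S := fun S => by
    have := freelyStable_deleteChord hf (a := a) (S := S); rwa [hfa] at this
  have hf'nc : ∀ x y, ¬(x < y ∧ y < f' x ∧ f' x < f' y) := by
    intro x y
    have := hfnc x y
    simp only [hf'def, deleteChord]
    grind
  have hf'eq : ∀ S : Finset α, a ∉ S → b ∉ S → openerSign f' S = openerSign f S := fun S ha hb =>
    openerSign_congr fun x hx => by simp only [hf'def, deleteChord]; grind
  have hk' : #{x | f' x ≠ x} < k := by
    rw [← hk]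
    refine card_lt_card ⟨fun x => ?_, fun h => ?_⟩
    · simp only [mem_filter, mem_univ, true_and, hf'def, deleteChord]; grind
    · have := @h a (by simp [hfa, hlt.ne'])
      simp [hf'def, deleteChord] at this
  by_cases hgfix : g a = a ∨ g b = b
  · have hnot : ∀ S, FreelyStable f S → FreelyStable g S → a ∉ S ∧ b ∉ S := by
      intro S h1 h2
      have := hmem S h1
      have := h2 a
      have := h2 b
      grind
    have hiff : ∀ S, FreelyStable f S ∧ FreelyStable g S ↔
        FreelyStable f' S ∧ FreelyStable g S := fun S => by
      have := hnot S
      rw [hstab]; tauto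
    rw [← ih _ hk' hf' hg hf'nc (fun S h1 h2 => hgnc S ((hstab S).1 h1).1 h2)
      ⟨S₀, ⟨x₀, hx₀⟩, (hiff S₀).1 ⟨hS₀f, hS₀g⟩⟩ rfl]
    refine sum_congr (filter_congr fun S _ => hiff S) fun S hS => ?_
    simp only [mem_filter, mem_univ, true_and, hstab] at hS
    rw [cycleSign, cycleSign, hf'eq S hS.1.2.1 hS.1.2.2]
  push Not at hgfix
  obtain ⟨hga, hgb⟩ := hgfix
  by_cases hgab : g a = b
  · have hgba : g b = a := by rw [← hgab, hg]
    have hanti : ∀ S, FreelyStable f S → a ∉ S → b ∉ S →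
        cycleSign f g (insert a (insert b S)) = -cycleSign f g S := by
      intro S hS ha hb
      rw [cycleSign, cycleSign, card_insert_pair hlt ha hb,
        openerSign_insert_pair hlt ha hb (hgap S hS) hfa hfb,
        openerSign_insert_pair hlt ha hb (hgap S hS) hgab hgba, Nat.add_div_right _ two_pos,
        pow_succ]
      linear_combination (-(-1) ^ (#S / 2) * openerSign f S * openerSign g S) *
        posSign_mul_self S a
    have hins : ∀ S, FreelyStable f S ∧ FreelyStable g S →
        FreelyStable f (insert a (insert b S)) ∧ FreelyStable g (insert a (insert b S)) := by
      rintro S ⟨h1, h2⟩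
      have h3 := freelyStable_insert_pair (a := a) hf (by rw [hfa]; exact hlt.ne') h1
      have h4 := freelyStable_insert_pair (a := a) hg hga h2
      rw [hfa] at h3
      rw [hgab] at h4
      exact ⟨h3, h4⟩
    have hera : ∀ S, FreelyStable f S ∧ FreelyStable g S →
        FreelyStable f ((S.erase a).erase b) ∧ FreelyStable g ((S.erase a).erase b) := by
      rintro S ⟨h1, h2⟩
      have h3 := freelyStable_erase_pair (a := a) hf h1
      have h4 := freelyStable_erase_pair (a := a) hg h2
      rw [hfa] at h3
      rw [hgab] at h4
      exact ⟨h3, h4⟩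
    have hback : ∀ S : Finset α, a ∈ S → b ∈ S →
        insert a (insert b ((S.erase a).erase b)) = S := by
      intro S ha hb; ext x; simp only [mem_insert, mem_erase]; grind
    refine sum_involution
      (fun S _ => if a ∈ S then (S.erase a).erase b else insert a (insert b S)) ?_ ?_ ?_ ?_
    · intro S hS
      simp only [mem_filter, mem_univ, true_and] at hS
      have hm := hmem S hS.1
      split_ifs with ha
      · have := hanti _ (hera S hS).1 (by simp) (by simp)
        rw [hback S ha (hm.1 ha)] at this
        rw [this]; ring
      · rw [hanti S hS.1 ha (by tauto)]; ring
    · intro S hS _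
      split_ifs with ha
      · intro h; rw [← h] at ha; simp at ha
      · intro h; rw [← h] at ha; simp at ha
    · intro S hS
      simp only [mem_filter, mem_univ, true_and] at hS ⊢
      split_ifs with ha
      · exact hera S hS
      · exact hins S hS
    · intro S hS
      simp only [mem_filter, mem_univ, true_and] at hS
      have hm := hmem S hS.1
      by_cases ha : a ∈ S
      · simp only [ha, if_true]
        rw [if_neg (by simp), hback S ha (hm.1 ha)]
      · simp only [ha, if_false]
        rw [if_pos (by simp)]
        ext x; simp only [mem_insert, mem_erase]; grind
  · set g' := contractChord g a b with hg'def
    have hgba : g b ≠ a := fun h => hgab (by rw [← h, hg])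
    have hg' : Function.Involutive g' := contractChord_involutive hg hga hgb hgab
    have hg'c : g' (g a) = g b := contractChord_apply_left hga hgab
    have hg'd : g' (g b) = g a := contractChord_apply_right hg hgb hgab
    have hg'eq : ∀ S : Finset α, a ∉ S → b ∉ S → ∀ x ∈ S, x ≠ g a → x ≠ g b → g' x = g x :=
      fun S ha hb => contractChord_apply_of_ne ha hb
    have hmemc : ∀ S, FreelyStable g S → (a ∈ S ↔ g a ∈ S) := fun S hS =>
      ⟨fun h => (hS a h).1, fun h => by have := (hS _ h).1; rwa [hg] at this⟩
    have hmemcd : ∀ S, FreelyStable g' S → (g a ∈ S ↔ g b ∈ S) := fun S hS =>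
      ⟨fun h => hg'c ▸ (hS _ h).1, fun h => hg'd ▸ (hS _ h).1⟩
    have hfwd : ∀ S, FreelyStable f' S ∧ FreelyStable g' S →
        FreelyStable f (uncontract a b (g a) S) ∧ FreelyStable g (uncontract a b (g a) S) := by
      rintro S ⟨h1, h2⟩
      obtain ⟨h1, -, -⟩ := (hstab S).1 h1
      unfold uncontract
      split_ifs with hc
      · have h3 := freelyStable_insert_pair (a := a) hf (by rw [hfa]; exact hlt.ne') h1
        rw [hfa] at h3
        exact ⟨h3, freelyStable_insert_of_contractChord hg hgab hga hgb h2 hc⟩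
      · exact ⟨h1, freelyStable_of_contractChord hg hgab h2 hc⟩
    have hbwd : ∀ S, FreelyStable f S ∧ FreelyStable g S →
        FreelyStable f' ((S.erase a).erase b) ∧ FreelyStable g' ((S.erase a).erase b) := by
      rintro S ⟨h1, h2⟩
      have h3 := freelyStable_erase_pair (a := a) hf h1
      rw [hfa] at h3
      exact ⟨(hstab _).2 ⟨h3, by simp, by simp⟩,
        freelyStable_contractChord hg hlt.ne hgab h2 (hmem S h1)⟩
    have hsign : ∀ S, FreelyStable f' S ∧ FreelyStable g' S →
        cycleSign f' g' S = cycleSign f g (uncontract a b (g a) S) := by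
      intro S hS
      obtain ⟨h1, ha, hb⟩ := (hstab S).1 hS.1
      have hu := hfwd S hS
      unfold uncontract at hu ⊢
      split_ifs at hu ⊢ with hc
      · rw [cycleSign, cycleSign, card_insert_pair hlt ha hb,
          openerSign_insert_pair hlt ha hb (hgap S h1) hfa hfb,
          openerSign_insert_pair_contract hlt ha hb (hgap S h1) hg hu.2 (hgnc _ hu.1 hu.2) hgab
            hg'c hg'd (hg'eq S ha hb), hf'eq S ha hb, Nat.add_div_right _ two_pos, pow_succ]
        linear_combination (-(-1) ^ (#S / 2) * openerSign f S * openerSign g' S) *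
          posSign_mul_self S a
      · have hd : g b ∉ S := fun h => hc ((hmemcd S hS.2).2 h)
        rw [cycleSign, cycleSign, hf'eq S ha hb, openerSign_congr (f := g') (g := g)]
        exact fun x hx => hg'eq S ha hb x hx (fun h => hc (h ▸ hx)) (fun h => hd (h ▸ hx))
    have hleft : ∀ S, FreelyStable f' S ∧ FreelyStable g' S →
        ((uncontract a b (g a) S).erase a).erase b = S := by
      intro S hS
      obtain ⟨h1, ha, hb⟩ := (hstab S).1 hS.1
      unfold uncontract
      ext x; split_ifs <;> simp only [mem_insert, mem_erase] <;> grind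
    have hright : ∀ S, FreelyStable f S ∧ FreelyStable g S →
        uncontract a b (g a) ((S.erase a).erase b) = S := by
      intro S hS
      have h1 := hmem S hS.1
      have h2 := hmemc S hS.2
      unfold uncontract
      ext x; simp only [mem_erase]
      split_ifs <;> simp only [mem_insert, mem_erase] <;> grind
    have hcross : ∀ S, FreelyStable f' S → FreelyStable g' S → NoncrossingOn g' S := by
      intro S h1 h2
      obtain ⟨hu1, hu2⟩ := hfwd S ⟨h1, h2⟩
      obtain ⟨h1, ha, hb⟩ := (hstab S).1 h1
      exact noncrossingOn_contractChord hg hlt ha hb (hgap S h1) hgab hga hgb h2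
        (hgnc _ hu1 hu2)
    rw [← ih _ hk' hf' hg' hf'nc hcross ?_ rfl]
    · symm
      refine sum_bij' (fun S _ => uncontract a b (g a) S) (fun S _ => (S.erase a).erase b)
        ?_ ?_ ?_ ?_ ?_
      · intro S hS; simpa using hfwd S (by simpa using hS)
      · intro S hS; simpa using hbwd S (by simpa using hS)
      · intro S hS; exact hleft S (by simpa using hS)
      · intro S hS; exact hright S (by simpa using hS)
      · intro S hS; exact hsign S (by simpa using hS)
    · refine ⟨(S₀.erase a).erase b, ?_, hbwd S₀ ⟨hS₀f, hS₀g⟩⟩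
      rw [nonempty_iff_ne_empty]
      intro h
      have := hright S₀ ⟨hS₀f, hS₀g⟩
      rw [h] at this
      simp [uncontract] at this
      simp [← this] at hx₀

end Involutions

/-- A symmetric product with an injective factor and an invertible diagonal has full rank. -/
lemma rank_mul_diagonal_mul_transpose {m n K : Type*} [Fintype m] [Fintype n] [DecidableEq n]
    [Field K] (V : Matrix m n K) (hV : Function.Injective V.mulVec) (d : n → K)
    (hd : ∀ i, d i ≠ 0) : (V * Matrix.diagonal d * V.transpose).rank = Fintype.card n := by
  classical
  apply le_antisymm
  · exact (Matrix.rank_mul_le_right _ _).trans (Matrix.rank_le_card_height _)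
  · obtain ⟨g, hg⟩ := LinearMap.exists_leftInverse_of_injective V.mulVecLin
      (LinearMap.ker_eq_bot.2 hV)
    have hB : LinearMap.toMatrix' g * V = 1 := by
      have := congrArg LinearMap.toMatrix' hg
      rwa [LinearMap.toMatrix'_comp, LinearMap.toMatrix'_id, ← Matrix.toLin'_apply',
        LinearMap.toMatrix'_toLin'] at this
    generalize LinearMap.toMatrix' g = B at hB
    have hB' : V.transpose * B.transpose = 1 := by
      rw [← Matrix.transpose_mul, hB, Matrix.transpose_one]
    have hD : Matrix.diagonal d = B * (V * Matrix.diagonal d * V.transpose) * B.transpose := by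
      rw [Matrix.mul_assoc, Matrix.mul_assoc _ V.transpose, hB', Matrix.mul_one,
        ← Matrix.mul_assoc, hB, Matrix.one_mul]
    have hrank : (Matrix.diagonal d).rank = Fintype.card n := by
      rw [Matrix.rank_diagonal]
      exact Fintype.card_congr (Equiv.subtypeUnivEquiv hd)
    rw [← hrank]
    nth_rewrite 1 [hD]
    exact (Matrix.rank_mul_le_left _ _).trans (Matrix.rank_mul_le_right _ _)

/-- A set of `n ≥ 1` points has `2 ^ (n - 1)` subsets of even cardinality. -/
lemma card_even_finset {n : ℕ} (hn : 1 ≤ n) :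
    Fintype.card {S : Finset (Fin n) // Even #S} = 2 ^ (n - 1) := by
  have : Nonempty (Fin n) := ⟨⟨0, hn⟩⟩
  have h0 : ∑ S : Finset (Fin n), (-1 : ℤ) ^ #S = 0 := by
    rw [← powerset_univ]
    exact sum_powerset_neg_one_pow_card_of_nonempty univ_nonempty
  have h1 : ∑ S : Finset (Fin n), (1 : ℤ) = 2 ^ n := by simp
  have h2 : ∑ S : Finset (Fin n), ((1 : ℤ) + (-1) ^ #S)
      = 2 * (Fintype.card {S : Finset (Fin n) // Even #S} : ℤ) := by
    rw [Fintype.card_subtype, card_filter, Nat.cast_sum, mul_sum]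
    refine sum_congr rfl fun S _ => ?_
    rcases Nat.even_or_odd #S with h | h
    · simp [h, h.neg_one_pow]
    · simp [Nat.not_even_iff_odd.2 h, h.neg_one_pow]
  rw [sum_add_distrib, h0, h1, add_zero] at h2
  obtain ⟨k, rfl⟩ : ∃ k, n = k + 1 := ⟨n - 1, by omega⟩
  rw [pow_succ'] at h2
  have := mul_left_cancel₀ two_ne_zero h2
  exact_mod_cast this.symm

section Partner

variable {n : ℕ} {M N : Finset (Fin n × Fin n)}

open Classical in
/-- The other endpoint of the chord at `x`, or `x` itself if `x` is unmatched. -/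
noncomputable def partner (M : Finset (Fin n × Fin n)) (x : Fin n) : Fin n :=
  if h : ∃ y, (x, y) ∈ M ∨ (y, x) ∈ M then h.choose else x

lemma partner_eq (hM : IsNCPM n M) {x y : Fin n} (h : (x, y) ∈ M ∨ (y, x) ∈ M) :
    partner M x = y := by
  have hex : ∃ y, (x, y) ∈ M ∨ (y, x) ∈ M := ⟨y, h⟩
  rw [partner, dif_pos hex]
  have hs := hex.choose_spec
  generalize hex.choose = z at hs
  obtain ⟨h1, h2, -⟩ := hM
  rcases h with h | h <;> rcases hs with hs | hs <;>
    have hlt := h1 _ h <;> have hlt' := h1 _ hs <;> have := h2 _ h _ hs <;> grind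

lemma partner_mem_or_eq (M : Finset (Fin n × Fin n)) (x : Fin n) :
    ((x, partner M x) ∈ M ∨ (partner M x, x) ∈ M) ∨ partner M x = x := by
  rw [partner]
  split_ifs with h
  · exact Or.inl h.choose_spec
  · exact Or.inr rfl

lemma partner_ne (hM : IsNCPM n M) {x : Fin n}
    (h : (x, partner M x) ∈ M ∨ (partner M x, x) ∈ M) : partner M x ≠ x := by
  rcases h with h | h
  · exact (hM.1 _ h).ne'
  · exact (hM.1 _ h).ne

lemma partner_involutive (hM : IsNCPM n M) : Function.Involutive (partner M) := by
  intro x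
  rcases partner_mem_or_eq M x with h | h
  · exact partner_eq hM h.symm
  · rw [h, h]

lemma mem_of_lt_partner (hM : IsNCPM n M) {x : Fin n} (h : x < partner M x) :
    (x, partner M x) ∈ M := by
  rcases partner_mem_or_eq M x with (h' | h') | h'
  · exact h'
  · exact absurd (hM.1 _ h') h.not_gt
  · exact absurd h' h.ne'

lemma partner_noncrossing (hM : IsNCPM n M) (x y : Fin n) :
    ¬(x < y ∧ y < partner M x ∧ partner M x < partner M y) := fun h =>
  hM.2.2 _ (mem_of_lt_partner hM (h.1.trans h.2.1)) _ (mem_of_lt_partner hM (h.2.1.trans h.2.2)) h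

lemma mem_matchedSet {x : Fin n} :
    x ∈ matchedSet M ↔ ∃ p ∈ M, x = p.1 ∨ x = p.2 := by
  simp [matchedSet]

lemma freelyStable_matchedSet (hM : IsNCPM n M) {A : Finset (Fin n × Fin n)} (hA : A ⊆ M) :
    FreelyStable (partner M) (matchedSet A) := by
  intro x hx
  obtain ⟨⟨a, b⟩, hp, hx⟩ := mem_matchedSet.1 hx
  have hlt : a < b := hM.1 _ (hA hp)
  rcases hx with rfl | rfl
  · rw [partner_eq hM (Or.inl (hA hp))]
    exact ⟨mem_matchedSet.2 ⟨_, hp, Or.inr rfl⟩, hlt.ne'⟩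
  · rw [partner_eq hM (Or.inr (hA hp))]
    exact ⟨mem_matchedSet.2 ⟨_, hp, Or.inl rfl⟩, hlt.ne⟩

lemma subset_matchedSet {S : Finset (Fin n)} (hS : FreelyStable (partner M) S) :
    S ⊆ matchedSet M := by
  intro x hx
  rcases partner_mem_or_eq M x with (h | h) | h
  · exact mem_matchedSet.2 ⟨_, h, Or.inl rfl⟩
  · exact mem_matchedSet.2 ⟨_, h, Or.inr rfl⟩
  · exact absurd h (hS x hx).2

lemma matchedSet_filter (hM : IsNCPM n M) {S : Finset (Fin n)}
    (hS : FreelyStable (partner M) S) : matchedSet {p ∈ M | p.1 ∈ S} = S := by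
  ext x
  rw [mem_matchedSet]
  constructor
  · rintro ⟨⟨a, b⟩, hp, hx⟩
    obtain ⟨hp, ha⟩ := mem_filter.1 hp
    rcases hx with rfl | rfl
    · exact ha
    · exact partner_eq hM (Or.inl hp) ▸ (hS a ha).1
  · intro hx
    rcases partner_mem_or_eq M x with (h | h) | h
    · exact ⟨_, mem_filter.2 ⟨h, hx⟩, Or.inl rfl⟩
    · exact ⟨_, mem_filter.2 ⟨h, (hS x hx).1⟩, Or.inr rfl⟩
    · exact absurd h (hS x hx).2

lemma hasCycle_iff (hM : IsNCPM n M) (hN : IsNCPM n N) :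
    HasCycle M N ↔ ∃ S : Finset (Fin n), S.Nonempty ∧ FreelyStable (partner M) S ∧
      FreelyStable (partner N) S := by
  constructor
  · rintro ⟨A, hA, ⟨p, hp⟩, B, hB, -, h⟩
    exact ⟨matchedSet A, ⟨p.1, mem_matchedSet.2 ⟨p, hp, Or.inl rfl⟩⟩,
      freelyStable_matchedSet hM hA, h ▸ freelyStable_matchedSet hN hB⟩
  · rintro ⟨S, ⟨x, hx⟩, h1, h2⟩
    have hne : ∀ A : Finset (Fin n × Fin n), matchedSet A = S → A.Nonempty := by
      intro A hA
      obtain ⟨p, hp, -⟩ := mem_matchedSet.1 (hA ▸ hx)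
      exact ⟨p, hp⟩
    have e1 := matchedSet_filter hM h1
    have e2 := matchedSet_filter hN h2
    exact ⟨_, filter_subset _ _, hne _ e1, _, filter_subset _ _, hne _ e2, e1.trans e2.symm⟩

/-- Pairing consecutive points matches any set of even cardinality. -/
lemma exists_isNCPM_matchedSet_eq (S : Finset (Fin n)) (hS : Even #S) :
    ∃ M, IsNCPM n M ∧ matchedSet M = S := by
  induction hk : #S using Nat.strong_induction_on generalizing S with
  | _ k ih =>
  rcases S.eq_empty_or_nonempty with rfl | hne
  · exact ⟨∅, by simp [IsNCPM], by simp [matchedSet]⟩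
  have ha := S.min'_mem hne
  have hamin : ∀ x ∈ S, S.min' hne ≤ x := fun x hx => S.min'_le x hx
  generalize S.min' hne = a at ha hamin
  have hcard := card_erase_of_mem ha
  have hpos := card_pos.2 hne
  have hne' : (S.erase a).Nonempty := by
    rw [← card_pos]
    obtain ⟨r, hr⟩ := hS
    omega
  have hb := (S.erase a).min'_mem hne'
  have hbmin : ∀ x ∈ S.erase a, (S.erase a).min' hne' ≤ x :=
    fun x hx => (S.erase a).min'_le x hx
  generalize (S.erase a).min' hne' = b at hb hbmin
  have hcard' := card_erase_of_mem hb
  obtain ⟨hba, hbS⟩ := mem_erase.1 hb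
  have hab : a < b := (hamin b hbS).lt_of_ne hba.symm
  have hpos' := card_pos.2 hne'
  obtain ⟨M, ⟨h1, h2, h3⟩, hMS⟩ := ih #((S.erase a).erase b) (by omega) _
    (by obtain ⟨r, hr⟩ := hS; exact ⟨r - 1, by omega⟩) rfl
  have hlt : ∀ p ∈ M, b < p.1 ∧ b < p.2 := by
    intro p hp
    have m1 : p.1 ∈ (S.erase a).erase b := hMS ▸ mem_matchedSet.2 ⟨p, hp, Or.inl rfl⟩
    have m2 : p.2 ∈ (S.erase a).erase b := hMS ▸ mem_matchedSet.2 ⟨p, hp, Or.inr rfl⟩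
    exact ⟨(hbmin _ (mem_of_mem_erase m1)).lt_of_ne (ne_of_mem_erase m1).symm,
      (hbmin _ (mem_of_mem_erase m2)).lt_of_ne (ne_of_mem_erase m2).symm⟩
  refine ⟨insert (a, b) M, ⟨?_, ?_, ?_⟩, ?_⟩
  · intro p hp
    rcases mem_insert.1 hp with rfl | hp
    · exact hab
    · exact h1 p hp
  · intro p hp q hq hpq
    rcases mem_insert.1 hp with rfl | hp <;> rcases mem_insert.1 hq with rfl | hq
    · exact absurd rfl hpq
    · obtain ⟨i, j⟩ := hlt q hq
      exact ⟨(hab.trans i).ne, (hab.trans j).ne, i.ne, j.ne⟩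
    · obtain ⟨i, j⟩ := hlt p hp
      exact ⟨(hab.trans i).ne', i.ne', (hab.trans j).ne', j.ne'⟩
    · exact h2 p hp q hq hpq
  · intro p hp q hq hpq
    rcases mem_insert.1 hp with rfl | hp <;> rcases mem_insert.1 hq with rfl | hq
    · exact hpq.1.false
    · exact ((hlt q hq).1.trans hpq.2.1).false
    · exact ((hab.trans (hlt p hp).1).trans hpq.1).false
    · exact h3 p hp q hq hpq
  · rw [matchedSet, biUnion_insert, ← matchedSet, hMS]
    ext x
    simp only [mem_union, mem_insert, mem_singleton, mem_erase]
    grind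

end Partner

/-- The matrix of signed incidences between noncrossing partial matchings and even sets. -/
noncomputable def incidence (n : ℕ) : Matrix (NCPM n) {S : Finset (Fin n) // Even #S} ℚ :=
  Matrix.of fun M S =>
    if FreelyStable (partner M.1) S.1 then openerSign (partner M.1) S.1 else 0

lemma incidence_mulVec_injective (n : ℕ) : Function.Injective (incidence n).mulVec := by
  refine (injective_iff_map_eq_zero (incidence n).mulVecLin).2 fun v hv => ?_
  rw [Matrix.mulVecLin_apply] at hv
  ext S
  induction hk : #S.1 using Nat.strong_induction_on generalizing S with
  | _ k ih =>
  obtain ⟨M, hM, hMS⟩ := exists_isNCPM_matchedSet_eq S.1 S.2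
  have h := congrFun hv ⟨M, hM⟩
  rw [Matrix.mulVec, dotProduct, sum_eq_single S] at h
  · rw [incidence, Matrix.of_apply,
      if_pos (hMS ▸ freelyStable_matchedSet hM (subset_refl M))] at h
    refine (mul_eq_zero.1 h).resolve_left fun h0 => ?_
    have := openerSign_mul_self (partner M) S.1
    rw [h0] at this
    simp at this
  · intro T _ hT
    rw [incidence, Matrix.of_apply]
    split_ifs with hst
    · have hss : T.1 ⊂ S.1 :=
        (hMS ▸ subset_matchedSet hst).ssubset_of_ne fun h => hT (Subtype.ext h)
      rw [ih _ (hk ▸ card_lt_card hss) T rfl, Pi.zero_apply, mul_zero]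
    · rw [zero_mul]
  · simp

lemma gram_eq_incidence_mul (n : ℕ) :
    (Matrix.of fun M N : NCPM n => if HasCycle M.1 N.1 then (0 : ℚ) else 1)
      = incidence n *
        Matrix.diagonal (fun S : {S : Finset (Fin n) // Even #S} => (-1 : ℚ) ^ (#S.1 / 2)) *
        (incidence n).transpose := by
  ext M N
  have hf := partner_involutive M.2
  have hg := partner_involutive N.2
  have hsum : (incidence n *
        Matrix.diagonal (fun S : {S : Finset (Fin n) // Even #S} => (-1 : ℚ) ^ (#S.1 / 2))
      * (incidence n).transpose) M N
      = ∑ S with FreelyStable (partner M.1) S ∧ FreelyStable (partner N.1) S,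
          cycleSign (partner M.1) (partner N.1) S := by
    rw [Matrix.mul_apply, sum_filter]
    simp only [Matrix.mul_diagonal, Matrix.transpose_apply, incidence, Matrix.of_apply]
    rw [← sum_subtype (univ.filter fun S : Finset (Fin n) => Even #S) (by simp)
      (fun S => (if FreelyStable (partner M.1) S then openerSign (partner M.1) S else 0) *
        (-1) ^ (#S / 2) * (if FreelyStable (partner N.1) S then openerSign (partner N.1) S else 0)),
      sum_filter]
    refine sum_congr rfl fun S _ => ?_
    by_cases h1 : FreelyStable (partner M.1) S
    · by_cases h2 : FreelyStable (partner N.1) S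
      · simp only [even_card_of_freelyStable hf h1, h1, h2, and_self, if_true, cycleSign]
        ring
      · simp [h2]
    · simp [h1]
  rw [hsum, Matrix.of_apply]
  split_ifs with h
  · exact (sum_cycleSign_eq_zero hf hg (partner_noncrossing M.2)
      (fun S _ _ x _ y _ => partner_noncrossing N.2 x y) ((hasCycle_iff M.2 N.2).1 h)).symm
  · rw [hasCycle_iff M.2 N.2] at h
    rw [sum_eq_single ∅]
    · simp [cycleSign, openerSign]
    · intro S hS hne
      exact absurd ⟨S, nonempty_iff_ne_empty.2 hne, (mem_filter.1 hS).2⟩ h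
    · intro h
      exact absurd (mem_filter.2 ⟨mem_univ _, by simp [FreelyStable], by simp [FreelyStable]⟩) h

/-- For `n ≥ 1`, the Gram matrix `(⟨e_M, e_N⟩)` of the form on `P_n`,
indexed by the non-crossing partial matchings of `[n]`, has rank `2^(n-1)` over `ℚ`. -/
theorem gram_rank (n : ℕ) (hn : 1 ≤ n) :
    (Matrix.of fun M N : NCPM n => if HasCycle M.1 N.1 then (0 : ℚ) else 1).rank
      = 2 ^ (n - 1) := by
  rw [gram_eq_incidence_mul, rank_mul_diagonal_mul_transpose _ (incidence_mulVec_injective n) _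
    (fun S => pow_ne_zero _ (by norm_num)), card_even_finset hn]
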